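/- Let M ≥ 2, N ≥ 2, let ρ be a positive semidefinite matrix on ℂ^M ⊗ ℂ^N, and let α be real with max(-(2N-1)/(N+(N+2)(M-1)), -1/2) ≤ α ≤ 1/2. Then the matrix Λ_0^{M×N}(ρ) := (N-1)·ε(ρ) + ∑_{i=0}^{M-2} ∑_{j=0}^{N-1} ε(S_A^i S_B^j · ρ · (S_A^i S_B^j)†) + ε(S_A^{M-1} · ρ · (S_A^{M-1})†) + α·ρ is separable. -/

import Mathlib

open Matrix Kronecker
open scoped ComplexOrder

noncomputable section

/-- A Hermitian matrix on ℂ^M ⊗ ℂ^N is separable if it is a finite sum of Kronecker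
products of positive semidefinite matrices. -/
def IsSeparableMat {M N : ℕ} (σ : Matrix (Fin M × Fin N) (Fin M × Fin N) ℂ) : Prop :=
  ∃ (k : ℕ) (A : Fin k → Matrix (Fin M) (Fin M) ℂ) (B : Fin k → Matrix (Fin N) (Fin N) ℂ),
    (∀ i, (A i).PosSemidef) ∧ (∀ i, (B i).PosSemidef) ∧ σ = ∑ i, A i ⊗ₖ B i

/-- The pinching onto the diagonal in the standard basis. -/
def pinch {ι : Type*} [DecidableEq ι] (X : Matrix ι ι ℂ) : Matrix ι ι ℂ :=
  Matrix.diagonal (fun i => X i i)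

/-- The cyclic shift unitary on ℂ^d : S|j⟩ = |j+1 mod d⟩. -/
def shift (d : ℕ) : Matrix (Fin d) (Fin d) ℂ :=
  fun i j => if (i : ℕ) = ((j : ℕ) + 1) % d then 1 else 0

end

theorem isSeparableMat_sum_kronecker {M N : ℕ} {ι : Type*} [Fintype ι]
    (A : ι → Matrix (Fin M) (Fin M) ℂ) (B : ι → Matrix (Fin N) (Fin N) ℂ)
    (hA : ∀ i, (A i).PosSemidef) (hB : ∀ i, (B i).PosSemidef) :
    IsSeparableMat (∑ i, A i ⊗ₖ B i) := by
  refine ⟨Fintype.card ι, fun i => A ((Fintype.equivFin ι).symm i),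
    fun i => B ((Fintype.equivFin ι).symm i), fun i => hA _, fun i => hB _, ?_⟩
  exact ((Fintype.equivFin ι).symm.sum_comp fun i => A i ⊗ₖ B i).symm

theorem IsSeparableMat.sum {M N : ℕ} {ι : Type*} (s : Finset ι)
    {σ : ι → Matrix (Fin M × Fin N) (Fin M × Fin N) ℂ} (h : ∀ i ∈ s, IsSeparableMat (σ i)) :
    IsSeparableMat (∑ i ∈ s, σ i) := by
  rw [← Finset.sum_coe_sort]
  choose k A B hA hB hσ using fun i : s => h i i.2
  simp_rw [hσ, ← Fintype.sum_sigma']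
  exact isSeparableMat_sum_kronecker (ι := Σ i : s, Fin (k i)) (fun p => A p.1 p.2)
    (fun p => B p.1 p.2) (fun p => hA _ _) fun p => hB _ _

theorem IsSeparableMat.add {M N : ℕ} {σ τ : Matrix (Fin M × Fin N) (Fin M × Fin N) ℂ}
    (hσ : IsSeparableMat σ) (hτ : IsSeparableMat τ) : IsSeparableMat (σ + τ) := by
  have := IsSeparableMat.sum (Finset.univ : Finset Bool) (σ := fun b => if b then σ else τ)
    fun b _ => by cases b <;> simpa
  simpa using this

theorem isSeparableMat_kronecker {M N : ℕ} {A : Matrix (Fin M) (Fin M) ℂ}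
    {B : Matrix (Fin N) (Fin N) ℂ} (hA : A.PosSemidef) (hB : B.PosSemidef) :
    IsSeparableMat (A ⊗ₖ B) :=
  ⟨1, fun _ => A, fun _ => B, fun _ => hA, fun _ => hB, by simp⟩

theorem IsSeparableMat.smul {M N : ℕ} {σ : Matrix (Fin M × Fin N) (Fin M × Fin N) ℂ}
    (hσ : IsSeparableMat σ) {t : ℂ} (ht : 0 ≤ t) : IsSeparableMat (t • σ) := by
  obtain ⟨k, A, B, hA, hB, rfl⟩ := hσ
  exact ⟨k, fun i => t • A i, B, fun i => (hA i).smul ht, hB, by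
    simp [Finset.smul_sum, smul_kronecker]⟩

theorem star_dotProduct_self_eq_sum_norm_sq {ι : Type*} [Fintype ι] (g : ι → ℂ) :
    star g ⬝ᵥ g = ((∑ i, ‖g i‖ ^ 2 : ℝ) : ℂ) := by
  simp [dotProduct, Complex.conj_mul']

/-- The Cauchy–Schwarz inequality as a matrix inequality `g gᴴ ≤ t • 1` for `gᴴ g ≤ t`. -/
theorem posSemidef_smul_one_sub_vecMulVec {ι : Type*} [Fintype ι] [DecidableEq ι] {g : ι → ℂ}
    {t : ℝ} (h : star g ⬝ᵥ g ≤ (t : ℂ)) :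
    ((t : ℂ) • (1 : Matrix ι ι ℂ) - vecMulVec g (star g)).PosSemidef := by
  rw [star_dotProduct_self_eq_sum_norm_sq, Complex.real_le_real] at h
  refine PosSemidef.of_dotProduct_mulVec_nonneg ?_ fun x => ?_
  · refine IsHermitian.sub ?_ (posSemidef_vecMulVec_self_star g).1
    simp [IsHermitian, conjTranspose_smul]
  · have h1 : star x ⬝ᵥ (((t : ℂ) • (1 : Matrix ι ι ℂ) - vecMulVec g (star g)) *ᵥ x)
        = ((t * ∑ i, ‖x i‖ ^ 2 - ‖star g ⬝ᵥ x‖ ^ 2 : ℝ) : ℂ) := by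
      rw [sub_mulVec, smul_mulVec, one_mulVec, dotProduct_sub, dotProduct_smul,
        star_dotProduct_self_eq_sum_norm_sq, vecMulVec_mulVec]
      have : star x ⬝ᵥ g = star (star g ⬝ᵥ x) := by
        rw [star_dotProduct]
      simp [dotProduct_smul, this, Complex.mul_conj']
    rw [h1, Complex.zero_le_real, sub_nonneg]
    calc ‖star g ⬝ᵥ x‖ ^ 2 ≤ (∑ i, ‖g i‖ * ‖x i‖) ^ 2 := by
          gcongr
          refine (norm_sum_le _ _).trans_eq ?_
          simp
      _ ≤ (∑ i, ‖g i‖ ^ 2) * ∑ i, ‖x i‖ ^ 2 := Finset.sum_mul_sq_le_sq_mul_sq _ _ _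
      _ ≤ t * ∑ i, ‖x i‖ ^ 2 := by gcongr

theorem posSemidef_smul_one_sub_vecMulVec_add {ι : Type*} [Fintype ι] [DecidableEq ι] {g : ι → ℂ}
    {t : ℝ} (h : star g ⬝ᵥ g ≤ (t : ℂ)) (k : ι → ℂ) :
    ((t : ℂ) • (1 : Matrix ι ι ℂ) - vecMulVec g (star g) + vecMulVec k (star k)).PosSemidef :=
  (posSemidef_smul_one_sub_vecMulVec h).add (posSemidef_vecMulVec_self_star k)

theorem isSeparableMat_coherence_of_orthogonal {M N : ℕ} (a b : Fin M → ℂ) {e f g : Fin N → ℂ}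
    {c s : ℝ} (hcs : c ^ 2 + s ^ 2 = 1) (he : star e ⬝ᵥ e = 1) (hg : star g ⬝ᵥ g ≤ 1)
    (heg : star e ⬝ᵥ g = 0) (hf : star f ⬝ᵥ f = 1) (hfe : f = (c : ℂ) • e + (s : ℂ) • g) :
    IsSeparableMat ((vecMulVec a (star a) + vecMulVec b (star b)) ⊗ₖ (1 : Matrix (Fin N) (Fin N) ℂ)
      + vecMulVec a (star b) ⊗ₖ vecMulVec e (star f)
      + vecMulVec b (star a) ⊗ₖ vecMulVec f (star e)) := by
  have hge : star g ⬝ᵥ e = 0 := by rw [star_dotProduct, heg, star_zero]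
  have hef : star e ⬝ᵥ f = c := by simp [hfe, he, heg]
  have hfe' : star f ⬝ᵥ e = c := by simp [hfe, he, hge]
  have h1 : star (e - f) ⬝ᵥ (e - f) ≤ ((2 * (1 - c) : ℝ) : ℂ) := by
    apply le_of_eq
    simp only [star_sub, sub_dotProduct, dotProduct_sub, he, hf, hef, hfe']
    push_cast; ring
  have h2 : star (e + f) ⬝ᵥ (e + f) ≤ ((2 * (1 + c) : ℝ) : ℂ) := by
    apply le_of_eq
    simp only [star_add, add_dotProduct, dotProduct_add, he, hf, hef, hfe']
    push_cast; ring
  have h3 : star (e - Complex.I • g) ⬝ᵥ (e - Complex.I • g) ≤ ((2 : ℝ) : ℂ) := by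
    have : star (e - Complex.I • g) ⬝ᵥ (e - Complex.I • g) = 1 + star g ⬝ᵥ g := by
      simp [he, heg, hge, ← mul_assoc]
    rw [this]
    exact (add_le_add_right hg 1).trans_eq (by norm_num)
  have h4 : star (e + Complex.I • g) ⬝ᵥ (e + Complex.I • g) ≤ ((2 : ℝ) : ℂ) := by
    have : star (e + Complex.I • g) ⬝ᵥ (e + Complex.I • g) = 1 + star g ⬝ᵥ g := by
      simp [he, heg, hge, ← mul_assoc]
    rw [this]
    exact (add_le_add_right hg 1).trans_eq (by norm_num)
  have hA := fun z : ℂ => posSemidef_vecMulVec_self_star (a + z • b)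
  have key := ((((isSeparableMat_kronecker (hA 1)
    (posSemidef_smul_one_sub_vecMulVec_add h1 (e + f))).add
    (isSeparableMat_kronecker (hA (-1))
    (posSemidef_smul_one_sub_vecMulVec_add h2 (e - f)))).add
    (isSeparableMat_kronecker (hA (c - Complex.I * s))
    (posSemidef_smul_one_sub_vecMulVec_add h3 (e + Complex.I • g)))).add
    (isSeparableMat_kronecker (hA (c + Complex.I * s))
    (posSemidef_smul_one_sub_vecMulVec_add h4 (e - Complex.I • g)))).smul
    (t := 1 / 8) (by positivity)
  convert key using 1
  have hI : Complex.I ^ 2 = -1 := Complex.I_sq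
  have hcs' : (c : ℂ) ^ 2 + (s : ℂ) ^ 2 = 1 := by exact_mod_cast hcs
  ext ⟨i, j⟩ ⟨k, l⟩
  simp only [hfe, Matrix.add_apply, Matrix.sub_apply, Matrix.smul_apply, kronecker_apply,
    vecMulVec_apply, Pi.star_apply, Pi.add_apply, Pi.sub_apply, Pi.smul_apply, smul_eq_mul,
    star_add, star_sub, star_mul', Complex.star_def, Complex.conj_I, Complex.conj_ofReal,
    map_neg, map_one]
  push_cast
  generalize (1 : Matrix (Fin N) (Fin N) ℂ) j l = δ
  generalize Complex.I = I at *
  generalize (c : ℂ) = c at *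
  generalize (s : ℂ) = s at *
  generalize a i = a1
  generalize b i = b1
  generalize (starRingEnd ℂ) (a k) = a2
  generalize (starRingEnd ℂ) (b k) = b2
  generalize e j = e1
  generalize g j = g1
  generalize (starRingEnd ℂ) (e l) = e2
  generalize (starRingEnd ℂ) (g l) = g2
  clear key hA h4 h3 h2 h1 hef hfe' hge hfe heg he hf hg
  grind

/-- A coherence `e fᴴ` between unit vectors costs no more than the identity on both sides. -/
theorem isSeparableMat_coherence_of_unit {M N : ℕ} (a b : Fin M → ℂ) {e f : Fin N → ℂ}
    (he : star e ⬝ᵥ e = 1) (hf : star f ⬝ᵥ f = 1) :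
    IsSeparableMat ((vecMulVec a (star a) + vecMulVec b (star b)) ⊗ₖ (1 : Matrix (Fin N) (Fin N) ℂ)
      + vecMulVec a (star b) ⊗ₖ vecMulVec e (star f)
      + vecMulVec b (star a) ⊗ₖ vecMulVec f (star e)) := by
  obtain ⟨u, hu, hc⟩ : ∃ u : ℂ, star u * u = 1 ∧ star e ⬝ᵥ f = ‖star e ⬝ᵥ f‖ * u := by
    obtain ⟨θ, hθ⟩ : ∃ θ : ℝ, ‖star e ⬝ᵥ f‖ * Complex.exp (θ * Complex.I) = star e ⬝ᵥ f :=
      ⟨_, Complex.norm_mul_exp_arg_mul_I _⟩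
    refine ⟨_, ?_, hθ.symm⟩
    rw [Complex.star_def, Complex.conj_mul', Complex.norm_exp_ofReal_mul_I]
    simp
  set c : ℝ := ‖star e ⬝ᵥ f‖
  set f' : Fin N → ℂ := star u • f with hf'
  have hff' : star f' ⬝ᵥ f' = 1 := by
    simp only [hf', star_smul, smul_dotProduct, dotProduct_smul, hf, star_star, smul_eq_mul,
      mul_one, hu]
  have hef' : star e ⬝ᵥ f' = c := by
    rw [hf', dotProduct_smul, hc, smul_eq_mul, mul_left_comm, hu, mul_one]
  have hfe' : star f' ⬝ᵥ e = c := by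
    rw [star_dotProduct, hef', Complex.star_def, Complex.conj_ofReal]
  have hh : star (f' - (c : ℂ) • e) ⬝ᵥ (f' - (c : ℂ) • e) = ((1 - c ^ 2 : ℝ) : ℂ) := by
    simp only [star_sub, sub_dotProduct, dotProduct_sub, star_smul, smul_dotProduct,
      dotProduct_smul, he, hff', hef', hfe', Complex.star_def, Complex.conj_ofReal, smul_eq_mul]
    push_cast; ring
  have hc1 : 0 ≤ 1 - c ^ 2 := by
    rw [← Complex.zero_le_real, ← hh]
    exact dotProduct_star_self_nonneg _
  set s : ℝ := √(1 - c ^ 2)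
  have hs2 : s ^ 2 = 1 - c ^ 2 := Real.sq_sqrt hc1
  have hsg : (s : ℂ) • ((s : ℂ)⁻¹ • (f' - (c : ℂ) • e)) = f' - (c : ℂ) • e := by
    rcases eq_or_ne s 0 with h0 | h0
    · rw [← hs2, h0] at hh
      have : f' - (c : ℂ) • e = 0 := dotProduct_star_self_eq_zero.1 (by simpa using hh)
      rw [this, smul_zero, smul_zero]
    · exact smul_inv_smul₀ (by exact_mod_cast h0) _
  have := isSeparableMat_coherence_of_orthogonal a (u • b) (e := e) (f := f')
    (g := (s : ℂ)⁻¹ • (f' - (c : ℂ) • e)) (c := c) (s := s) (by rw [hs2]; ring) he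
    (by
      simp only [star_smul, smul_dotProduct, dotProduct_smul, hh, ← hs2, smul_eq_mul, star_inv₀,
        Complex.star_def, Complex.conj_ofReal]
      rcases eq_or_ne (s : ℂ) 0 with h0 | h0
      · simp [h0]
      · apply le_of_eq
        push_cast
        field_simp)
    (by simp [dotProduct_smul, dotProduct_sub, hef', he]) hff' (by rw [hsg]; abel)
  convert this using 1
  ext ⟨i, j⟩ ⟨k, l⟩
  simp only [hf', Matrix.add_apply, kronecker_apply, vecMulVec_apply, Pi.star_apply, Pi.smul_apply,
    smul_eq_mul, star_mul', star_star]
  linear_combination (-a i * star (b k) * e j * star (f l) - b i * star (a k) * f j * star (e l)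
    - b i * star (b k) * (1 : Matrix (Fin N) (Fin N) ℂ) j l) * hu

theorem isSeparableMat_coherence {M N : ℕ} (k k' : Fin M) {v w : Fin N → ℂ} {x y P Q α : ℝ}
    (hx : 0 ≤ x) (hy : 0 ≤ y) (hv : star v ⬝ᵥ v = P) (hw : star w ⬝ᵥ w = Q)
    (hxy : x * y = α ^ 2 * (P * Q)) :
    IsSeparableMat (((x : ℂ) • single k k 1 + (y : ℂ) • single k' k' 1) ⊗ₖ
        (1 : Matrix (Fin N) (Fin N) ℂ)
      + (α : ℂ) • (single k k' 1 ⊗ₖ vecMulVec v (star w)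
        + single k' k 1 ⊗ₖ vecMulVec w (star v))) := by
  have hsingle : ∀ i j : Fin M,
      single i j (1 : ℂ) = vecMulVec (Pi.single i 1) (star (Pi.single j 1)) := by
    intro i j
    ext p q
    simp [single_apply, vecMulVec_apply, Pi.single_apply, ← ite_and, eq_comm, and_comm]
  have hdiag : IsSeparableMat (((x : ℂ) • single k k 1 + (y : ℂ) • single k' k' 1) ⊗ₖ
        (1 : Matrix (Fin N) (Fin N) ℂ)) := by
    refine isSeparableMat_kronecker (.add (.smul ?_ ?_) (.smul ?_ ?_)) .one
    · rw [hsingle]; exact posSemidef_vecMulVec_self_star _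
    · exact_mod_cast hx
    · rw [hsingle]; exact posSemidef_vecMulVec_self_star _
    · exact_mod_cast hy
  rcases eq_or_ne P 0 with rfl | hP0
  · have : v = 0 := dotProduct_star_self_eq_zero.1 (by simpa using hv)
    simpa [this] using hdiag
  rcases eq_or_ne Q 0 with rfl | hQ0
  · have : w = 0 := dotProduct_star_self_eq_zero.1 (by simpa using hw)
    simpa [this] using hdiag
  have hP : 0 < P := lt_of_le_of_ne (by
    rw [← Complex.zero_le_real, ← hv]; exact dotProduct_star_self_nonneg _) hP0.symm
  have hQ : 0 < Q := lt_of_le_of_ne (by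
    rw [← Complex.zero_le_real, ← hw]; exact dotProduct_star_self_nonneg _) hQ0.symm
  obtain ⟨ε, hε, hεα⟩ : ∃ ε : ℝ, ε ^ 2 = 1 ∧ ε * |α| = α := by
    rcases le_total 0 α with h | h
    · exact ⟨1, by norm_num, by rw [abs_of_nonneg h, one_mul]⟩
    · exact ⟨-1, by norm_num, by rw [abs_of_nonpos h]; ring⟩
  have hroot : √x * √y = |α| * (√P * √Q) := by
    rw [← Real.sqrt_mul hx, hxy, Real.sqrt_mul (sq_nonneg α), Real.sqrt_sq_eq_abs,
      Real.sqrt_mul hP.le]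
  have hp := Real.sq_sqrt hP.le
  have hq := Real.sq_sqrt hQ.le
  have hp' : ((√P : ℝ) : ℂ) ≠ 0 := by exact_mod_cast (Real.sqrt_pos.2 hP).ne'
  have hq' : ((√Q : ℝ) : ℂ) ≠ 0 := by exact_mod_cast (Real.sqrt_pos.2 hQ).ne'
  have key := isSeparableMat_coherence_of_unit ((√x : ℂ) • (Pi.single k 1 : Fin M → ℂ))
    ((ε * √y : ℂ) • (Pi.single k' 1 : Fin M → ℂ)) (e := (√P : ℂ)⁻¹ • v) (f := (√Q : ℂ)⁻¹ • w)
    (by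
      simp only [star_smul, smul_dotProduct, dotProduct_smul, hv, smul_eq_mul, star_inv₀,
        Complex.star_def, Complex.conj_ofReal]
      have : (P : ℂ) = (√P : ℂ) ^ 2 := by exact_mod_cast hp.symm
      rw [this]; field_simp)
    (by
      simp only [star_smul, smul_dotProduct, dotProduct_smul, hw, smul_eq_mul, star_inv₀,
        Complex.star_def, Complex.conj_ofReal]
      have : (Q : ℂ) = (√Q : ℂ) ^ 2 := by exact_mod_cast hq.symm
      rw [this]; field_simp)
  have hα : (√x : ℂ) * (ε * √y) * ((√P : ℂ)⁻¹ * (√Q : ℂ)⁻¹) = α := by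
    have : (√x : ℂ) * √y = (|α| : ℝ) * (√P * √Q) := by exact_mod_cast hroot
    rw [mul_left_comm (√x : ℂ), this]
    have hεα' : (ε : ℂ) * (|α| : ℝ) = α := by exact_mod_cast hεα
    field_simp
    exact hεα'
  have hxc : (√x : ℂ) * √x = x := by exact_mod_cast Real.mul_self_sqrt hx
  have hyc : (ε * √y : ℂ) * (ε * √y) = y := by
    have h1 : ((√y : ℝ) : ℂ) * √y = y := by exact_mod_cast Real.mul_self_sqrt hy
    have h2 : (ε : ℂ) ^ 2 = 1 := by exact_mod_cast hε
    linear_combination (ε : ℂ) ^ 2 * h1 + y * h2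
  convert key using 1
  simp only [hsingle]
  ext ⟨i, j⟩ ⟨p, q⟩
  simp only [Matrix.add_apply, Matrix.smul_apply, kronecker_apply, vecMulVec_apply, Pi.star_apply,
    Pi.smul_apply, smul_eq_mul, star_mul', star_inv₀, Complex.star_def, Complex.conj_ofReal,
    ← hxc, ← hyc, ← hα]
  ring

/-- From `v vᴴ ≤ N • diagonal |v|²`, since `N / 2 ≤ N - 1`. -/
theorem posSemidef_diagonal_add_smul_vecMulVec {N : ℕ} (hN : 2 ≤ N) (v : Fin N → ℂ) {α : ℝ}
    (hα : -(1 / 2) ≤ α) :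
    (diagonal (fun l => ((N : ℂ) - 1) * (v l * star (v l)))
      + (α : ℂ) • vecMulVec v (star v)).PosSemidef := by
  have h1 : (diagonal v * (((N : ℝ) : ℂ) • (1 : Matrix (Fin N) (Fin N) ℂ)
      - vecMulVec 1 (star 1)) * (diagonal v)ᴴ).PosSemidef :=
    (posSemidef_smul_one_sub_vecMulVec (by simp)).mul_mul_conjTranspose_same _
  have hN' : (0 : ℂ) ≤ ((N / 2 - 1 : ℝ) : ℂ) := by
    rw [Complex.zero_le_real]
    have : (2 : ℝ) ≤ N := by exact_mod_cast hN
    linarith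
  have h2 : (diagonal (fun l => v l * star (v l))).PosSemidef :=
    posSemidef_diagonal_iff.2 fun l => mul_star_self_nonneg _
  have hα' : (0 : ℂ) ≤ ((α + 1 / 2 : ℝ) : ℂ) := by
    rw [Complex.zero_le_real]; linarith
  have h3 : (0 : ℂ) ≤ 1 / 2 := by positivity
  convert ((h2.smul hN').add (h1.smul h3)).add
    ((posSemidef_vecMulVec_self_star v).smul hα') using 1
  ext i j
  simp only [Matrix.add_apply, Matrix.smul_apply, diagonal_apply, vecMulVec_apply, smul_eq_mul,
    diagonal_conjTranspose, mul_diagonal, diagonal_mul, Matrix.sub_apply, Matrix.one_apply,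
    Pi.star_apply, Pi.one_apply, star_one]
  split_ifs with h
  · subst h; push_cast; ring
  · push_cast; ring

theorem Fin.val_nsmul_one {d : ℕ} [NeZero d] (n : ℕ) : ((n • (1 : Fin d) : Fin d) : ℕ) = n % d := by
  induction n with
  | zero => simp
  | succ n ih => simp [succ_nsmul, Fin.val_add, ih]

theorem shift_pow_apply {d : ℕ} [NeZero d] (n : ℕ) (a b : Fin d) :
    (shift d ^ n) a b = if a = b + n • 1 then 1 else 0 := by
  induction n generalizing a with
  | zero => simp [Matrix.one_apply]
  | succ n ih =>
    have h : ∀ x y : Fin d, shift d x y = if x = y + 1 then 1 else 0 := fun x y => by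
      simp [shift, Fin.ext_iff, Fin.val_add]
    simp [pow_succ', Matrix.mul_apply, h, ih, succ_nsmul, add_assoc]

theorem kronecker_pow {m n : Type*} [Fintype m] [Fintype n] [DecidableEq m] [DecidableEq n]
    (A : Matrix m m ℂ) (B : Matrix n n ℂ) (k : ℕ) : (A ⊗ₖ B) ^ k = (A ^ k) ⊗ₖ (B ^ k) := by
  induction k with
  | zero => simp
  | succ k ih => rw [pow_succ, ih, ← mul_kronecker_mul, pow_succ, pow_succ]

theorem pinch_shift_conj {M N : ℕ} [NeZero M] [NeZero N]
    (ρ : Matrix (Fin M × Fin N) (Fin M × Fin N) ℂ) (i j : ℕ) :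
    pinch ((((shift M ⊗ₖ (1 : Matrix (Fin N) (Fin N) ℂ)) ^ i) *
                (((1 : Matrix (Fin M) (Fin M) ℂ) ⊗ₖ shift N) ^ j)) * ρ *
              ((((shift M ⊗ₖ (1 : Matrix (Fin N) (Fin N) ℂ)) ^ i) *
                (((1 : Matrix (Fin M) (Fin M) ℂ) ⊗ₖ shift N) ^ j))ᴴ))
      = diagonal fun p => ρ (p.1 - i • 1, p.2 - j • 1) (p.1 - i • 1, p.2 - j • 1) := by
  have h : ∀ p q : Fin M × Fin N, ((shift M ^ i) ⊗ₖ (shift N ^ j)) p q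
      = if q = (p.1 - i • 1, p.2 - j • 1) then 1 else 0 := by
    rintro ⟨a, b⟩ ⟨c, d⟩
    simp [shift_pow_apply, Prod.ext_iff, eq_sub_iff_add_eq, ← ite_and, eq_comm, and_comm]
  rw [kronecker_pow, kronecker_pow, ← mul_kronecker_mul, one_pow, one_pow, one_mul, mul_one, pinch]
  congr 1
  ext p
  simp only [Matrix.mul_apply, h, apply_ite star, conjTranspose_apply]
  simp

theorem sum_range_sub_nsmul_one {d : ℕ} [NeZero d] (f : Fin d → ℂ) (a : Fin d) :
    ∑ i ∈ Finset.range d, f (a - i • 1) = ∑ x, f x := by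
  rw [Finset.sum_range, ← Equiv.sum_comp (Equiv.subLeft a) f]
  refine Finset.sum_congr rfl fun i _ => ?_
  have : (i : ℕ) • (1 : Fin d) = i := Fin.ext (by simp [Fin.val_nsmul_one, Nat.mod_eq_of_lt i.2])
  simp [this]

theorem pred_nsmul_one {d : ℕ} [NeZero d] : (d - 1) • (1 : Fin d) = -1 := by
  rw [eq_neg_iff_add_eq_zero, ← succ_nsmul, Nat.sub_add_cancel NeZero.one_le]
  exact Fin.ext (by simp [Fin.val_nsmul_one])

theorem sum_range_pred_sub_nsmul_one {d : ℕ} [NeZero d] (f : Fin d → ℂ) (a : Fin d) :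
    ∑ i ∈ Finset.range (d - 1), f (a - i • 1) = ∑ x, f x - f (a + 1) := by
  have h := Finset.sum_range_succ (fun i => f (a - i • 1)) (d - 1)
  rw [Nat.sub_add_cancel NeZero.one_le, sum_range_sub_nsmul_one, pred_nsmul_one,
    sub_neg_eq_add] at h
  exact eq_sub_of_add_eq h.symm

theorem sum_pair_blocks {M N : ℕ} (x : Fin M → Fin M → ℂ) (α : ℂ) (ψ : Fin M × Fin N → ℂ) :
    ∑ k, ∑ k', ((x k k' • single k k 1 + x k' k • single k' k' 1) ⊗ₖ
        (1 : Matrix (Fin N) (Fin N) ℂ)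
      + α • (single k k' 1 ⊗ₖ vecMulVec (fun l => ψ (k, l)) (star fun l => ψ (k', l))
        + single k' k 1 ⊗ₖ vecMulVec (fun l => ψ (k', l)) (star fun l => ψ (k, l))))
      = (2 : ℂ) • (diagonal (fun p => ∑ k', x p.1 k') + α • vecMulVec ψ (star ψ)) := by
  ext ⟨i, j⟩ ⟨m, l⟩
  simp only [Matrix.sum_apply, Matrix.add_apply, Matrix.smul_apply, kronecker_apply, smul_eq_mul,
    single_apply, vecMulVec_apply, Pi.star_apply, diagonal_apply, Prod.mk.injEq, ite_and,
    Matrix.one_apply, Finset.sum_add_distrib, ← Finset.mul_sum, mul_ite, ite_mul,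
    mul_one, mul_zero, one_mul, zero_mul, Finset.sum_ite_eq', Finset.mem_univ,
    if_true]
  by_cases him : i = m <;> by_cases hjl : j = l <;>
    simp [him, hjl, Finset.sum_add_distrib, Finset.sum_ite_irrel] <;> ring

theorem sum_single_kronecker_diagonal {M N : ℕ} (d : Fin M → Fin N → ℂ) :
    ∑ k : Fin M, single k k 1 ⊗ₖ diagonal (d k) = diagonal fun p => d p.1 p.2 := by
  ext ⟨i, j⟩ ⟨m, l⟩
  by_cases him : i = m <;> by_cases hjl : j = l <;>
    simp [Matrix.sum_apply, single_apply, him, hjl, ite_and]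

theorem isSeparableMat_pure {M N : ℕ} [NeZero M] (hM : 2 ≤ M) (hN : 2 ≤ N)
    (ψ : Fin M × Fin N → ℂ) {α : ℝ} (hα1 : -(1 / 2) ≤ α) (hα2 : α ≤ 1 / 2) :
    IsSeparableMat (diagonal (fun p => ((N : ℂ) - 1) * (ψ p * star (ψ p))
        + (∑ k, ∑ l, ψ (k, l) * star (ψ (k, l)) - ∑ l, ψ (p.1 + 1, l) * star (ψ (p.1 + 1, l)))
        + ψ (p.1 + 1, p.2) * star (ψ (p.1 + 1, p.2)))
      + (α : ℂ) • vecMulVec ψ (star ψ)) := by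
  have hone : (1 : Fin M) ≠ 0 := by
    intro h
    have := congrArg Fin.val h
    simp [Nat.mod_eq_of_lt (show 1 < M from hM)] at this
  have hα : |α| ≤ 1 / 2 := abs_le.2 ⟨hα1, hα2⟩
  have hα0 := abs_nonneg α
  let P : Fin M → ℝ := fun k => ∑ l, ‖ψ (k, l)‖ ^ 2
  have hP : ∀ k, 0 ≤ P k := fun k => by positivity
  have hPψ : ∀ k, ∑ l, ψ (k, l) * star (ψ (k, l)) = (P k : ℂ) := fun k => by
    simp [P, Complex.mul_conj']
  let x : Fin M → Fin M → ℝ := fun k k' =>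
    if k = k' then 0 else |α| * if k' = k + 1 ∨ k' + 1 = k then P k else P k'
  have hx : ∀ k k', 0 ≤ x k k' := fun k k' => by
    simp only [x]
    split_ifs <;> first | exact le_rfl | exact mul_nonneg hα0 (hP _)
  have hxx : ∀ k k', k ≠ k' → x k k' * x k' k = α ^ 2 * (P k * P k') := fun k k' h => by
    have hcomm : (k = k' + 1 ∨ k + 1 = k') ↔ (k' = k + 1 ∨ k' + 1 = k) := by
      rw [or_comm, eq_comm, @eq_comm _ k]
    simp only [x, if_neg h, if_neg h.symm, hcomm]
    rw [← sq_abs]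
    split_ifs <;> ring
  have hsum : ∀ k, ∑ k', x k k' ≤ ∑ k', P k' - P (k + 1) := fun k => by
    calc ∑ k', x k k' ≤ ∑ k', ((if k' = k + 1 then 1 / 2 * P k else 0)
          + (if k' = k - 1 then 1 / 2 * P k else 0)
          + (P k' - if k' = k + 1 then P k' else 0) - if k' = k then P k' else 0) := by
          refine Finset.sum_le_sum fun k' _ => ?_
          have h1 := hP k
          have h2 := hP k'
          have h3 : |α| * P k ≤ 1 / 2 * P k := by gcongr
          have h4 : |α| * P k' ≤ 1 / 2 * P k' := by gcongr
          have h5 : k ≠ k + 1 := by simpa using hone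
          have h6 : k ≠ k - 1 := fun h => hone (sub_eq_self.1 h.symm)
          rcases eq_or_ne k k' with rfl | hkk
          · simp [x, hone, h6]
          · simp only [x, if_neg hkk, if_neg hkk.symm, eq_sub_iff_add_eq]
            by_cases h7 : k' = k + 1 <;> by_cases h8 : k' + 1 = k <;> simp only [h7, h8] <;>
              simp <;> (try split_ifs) <;> linarith
      _ = _ := by
          simp [Finset.sum_add_distrib, Finset.sum_sub_distrib]
          ring
  let R : Fin M → Fin N → ℝ := fun k l =>
    (∑ k', P k' - P (k + 1) - ∑ k', x k k') + ‖ψ (k + 1, l)‖ ^ 2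
  have hR : ∀ k l, 0 ≤ R k l := fun k l =>
    add_nonneg (sub_nonneg.2 (hsum k)) (by positivity)
  let v : Fin M → Fin N → ℂ := fun k l => ψ (k, l)
  have hv : ∀ k, star (v k) ⬝ᵥ v k = P k := fun k => star_dotProduct_self_eq_sum_norm_sq _
  have hpair : IsSeparableMat ((1 / 2 : ℂ) • ∑ k, ∑ k', if k = k' then 0 else
      (((x k k' : ℂ) • single k k 1 + (x k' k : ℂ) • single k' k' 1) ⊗ₖ
        (1 : Matrix (Fin N) (Fin N) ℂ)
      + (α : ℂ) • (single k k' 1 ⊗ₖ vecMulVec (v k) (star (v k'))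
        + single k' k 1 ⊗ₖ vecMulVec (v k') (star (v k))))) := by
    refine .smul (.sum _ fun k _ => .sum _ fun k' _ => ?_) (by positivity)
    split_ifs with h
    · exact ⟨0, 0, 0, by simp, by simp, by simp⟩
    · exact isSeparableMat_coherence k k' (hx _ _) (hx _ _) (hv k) (hv k') (hxx k k' h)
  have hrows : IsSeparableMat (∑ k : Fin M, single k k 1 ⊗ₖ
      (diagonal (fun l => ((N : ℂ) - 1) * (v k l * star (v k l)))
        + (α : ℂ) • vecMulVec (v k) (star (v k)) + diagonal (fun l => (R k l : ℂ)))) := by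
    refine .sum _ fun k _ => isSeparableMat_kronecker ?_
      ((posSemidef_diagonal_add_smul_vecMulVec hN (v k) hα1).add
        (posSemidef_diagonal_iff.2 fun l => by exact_mod_cast hR k l))
    rw [← diagonal_single]
    exact posSemidef_diagonal_iff.2 fun i => by
      by_cases h : i = k
      · subst h; simp
      · simp [h]
  convert hpair.add hrows using 1
  have hx0 : ∀ k, (x k k : ℂ) = 0 := fun k => by simp [x]
  have hsplit : ∀ T : Fin M → Fin M → Matrix (Fin M × Fin N) (Fin M × Fin N) ℂ,
      ∑ k, ∑ k', (if k = k' then 0 else T k k') = ∑ k, ∑ k', T k k' - ∑ k, T k k := fun T => by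
    rw [← Finset.sum_sub_distrib]
    refine Finset.sum_congr rfl fun k _ => ?_
    rw [← Finset.add_sum_erase _ _ (Finset.mem_univ k),
      ← Finset.add_sum_erase _ (T k) (Finset.mem_univ k), if_pos rfl, zero_add, add_sub_cancel_left]
    exact Finset.sum_congr rfl fun k' h => if_neg (Finset.ne_of_mem_erase h).symm
  have hrow : ∑ k : Fin M, single k k 1 ⊗ₖ
      (diagonal (fun l => ((N : ℂ) - 1) * (v k l * star (v k l)))
        + (α : ℂ) • vecMulVec (v k) (star (v k)) + diagonal (fun l => (R k l : ℂ)))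
      - (1 / 2 : ℂ) • ∑ k : Fin M, ((((x k k : ℂ) • single k k 1 + (x k k : ℂ) • single k k 1) ⊗ₖ
        (1 : Matrix (Fin N) (Fin N) ℂ)
      + (α : ℂ) • (single k k 1 ⊗ₖ vecMulVec (v k) (star (v k))
        + single k k 1 ⊗ₖ vecMulVec (v k) (star (v k)))))
      = diagonal fun p => ((N : ℂ) - 1) * (v p.1 p.2 * star (v p.1 p.2)) + (R p.1 p.2 : ℂ) := by
    rw [Finset.smul_sum, ← Finset.sum_sub_distrib, ← sum_single_kronecker_diagonal fun k l =>
      ((N : ℂ) - 1) * (v k l * star (v k l)) + (R k l : ℂ)]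
    refine Finset.sum_congr rfl fun k _ => ?_
    rw [hx0, ← diagonal_add, zero_smul, add_zero, zero_kronecker, zero_add, kronecker_add,
      kronecker_add, kronecker_add, kronecker_smul]
    module
  rw [hsplit, sum_pair_blocks (fun k k' => (x k k' : ℂ)) α ψ, smul_sub, sub_add_eq_add_sub,
    add_sub_assoc, hrow, smul_smul, one_div, inv_mul_cancel₀ two_ne_zero, one_smul,
    add_right_comm, diagonal_add]
  congr 2
  ext p
  simp only [hPψ]
  simp only [R, v, Complex.mul_conj', Complex.star_def]
  push_cast
  ring

open scoped MatrixOrder in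
theorem Matrix.PosSemidef.exists_eq_star_mul_self {n : Type*} [Fintype n] [DecidableEq n]
    {A : Matrix n n ℂ} (hA : A.PosSemidef) : ∃ B : Matrix n n ℂ, A = star B * B :=
  CStarAlgebra.nonneg_iff_eq_star_mul_self.mp hA.nonneg

theorem stmt19 {M N : ℕ} (hM : 2 ≤ M) (hN : 2 ≤ N)
    (ρ : Matrix (Fin M × Fin N) (Fin M × Fin N) ℂ) (hρ : ρ.PosSemidef)
    (α : ℝ)
    (hα1 : max (-(2 * (N : ℝ) - 1) / ((N : ℝ) + ((N : ℝ) + 2) * ((M : ℝ) - 1))) (-(1 / 2)) ≤ α)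
    (hα2 : α ≤ 1 / 2) :
    IsSeparableMat
      ((((N : ℝ) - 1 : ℝ) : ℂ) • pinch ρ
        + ∑ i ∈ Finset.range (M - 1), ∑ j ∈ Finset.range N,
            pinch ((((shift M ⊗ₖ (1 : Matrix (Fin N) (Fin N) ℂ)) ^ i) *
                (((1 : Matrix (Fin M) (Fin M) ℂ) ⊗ₖ shift N) ^ j)) * ρ *
              ((((shift M ⊗ₖ (1 : Matrix (Fin N) (Fin N) ℂ)) ^ i) *
                (((1 : Matrix (Fin M) (Fin M) ℂ) ⊗ₖ shift N) ^ j))ᴴ))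
        + pinch (((shift M ⊗ₖ (1 : Matrix (Fin N) (Fin N) ℂ)) ^ (M - 1)) * ρ *
            (((shift M ⊗ₖ (1 : Matrix (Fin N) (Fin N) ℂ)) ^ (M - 1))ᴴ))
        + (α : ℂ) • ρ) := by

  have : NeZero M := ⟨by omega⟩
  have : NeZero N := ⟨by omega⟩
  have hα : -(1 / 2) ≤ α := (le_max_right _ _).trans hα1
  obtain ⟨B, rfl⟩ := hρ.exists_eq_star_mul_self
  have hB : star B * B = ∑ r, vecMulVec (star (B r)) (B r) := by
    ext p q
    simp [Matrix.mul_apply, Matrix.sum_apply, vecMulVec_apply, star_eq_conjTranspose]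
  have hshift := fun i => pinch_shift_conj (star B * B) i 0
  simp only [pow_zero, mul_one, zero_smul, sub_zero] at hshift
  simp only [pinch_shift_conj, hshift]
  have key := IsSeparableMat.sum Finset.univ fun r _ =>
    isSeparableMat_pure hM hN (star (B r)) hα hα2
  convert key using 1
  rw [Finset.sum_add_distrib, ← Finset.smul_sum]
  simp only [star_star, ← hB]
  congr 1
  have hd : ∀ p, (star B * B) p p = ∑ r, star (B r p) * B r p := fun p => by
    simp [Matrix.mul_apply, star_eq_conjTranspose]
  have hcol : ∀ k l, ∑ j ∈ Finset.range N, (star B * B) (k, l - j • 1) (k, l - j • 1)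
      = ∑ l', (star B * B) (k, l') (k, l') := fun k =>
    sum_range_sub_nsmul_one fun l => (star B * B) (k, l) (k, l)
  have hrow : ∀ k, ∑ i ∈ Finset.range (M - 1), ∑ l, (star B * B) (k - i • 1, l) (k - i • 1, l)
      = ∑ k', ∑ l, (star B * B) (k', l) (k', l) - ∑ l, (star B * B) (k + 1, l) (k + 1, l) :=
    sum_range_pred_sub_nsmul_one fun k => ∑ l, (star B * B) (k, l) (k, l)
  ext p q
  by_cases hpq : p = q
  · subst hpq
    simp only [Matrix.add_apply, Matrix.smul_apply, Matrix.sum_apply, diagonal_apply_eq, pinch,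
      hcol, hrow, pred_nsmul_one, sub_neg_eq_add, Pi.star_apply, star_star, Finset.sum_add_distrib,
      Finset.sum_sub_distrib, ← Finset.mul_sum, smul_eq_mul]
    simp only [hd, Finset.sum_comm (s := (Finset.univ : Finset (Fin M × Fin N)))]
    push_cast
    rfl
  · simp [pinch, Matrix.sum_apply, hpq]
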